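/- Let z ∈ PL₊^>(I) be a one-bump function. Then the centralizer C(z) = { g ∈ PL₊(I) : g ∘ z = z ∘ g } of z in PL₊(I) is isomorphic, as a group, to the infinite cyclic group ℤ. -/

import Mathlib

open Set

/-- `f` is piecewise linear on `[0,1]` with finitely many breakpoints:
there is a partition `0 = t₀ < t₁ < ⋯ < tₙ = 1` such that `f` is affine on
each subinterval `[tᵢ, tᵢ₊₁]`. -/
def PiecewiseLinearOn (f : ℝ → ℝ) : Prop :=
  ∃ n : ℕ, ∃ t : Fin (n + 1) → ℝ, StrictMono t ∧ t 0 = 0 ∧ t (Fin.last n) = 1 ∧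
    ∀ i : Fin n, ∃ a b : ℝ, ∀ x ∈ Icc (t i.castSucc) (t i.succ), f x = a * x + b

/-- The group `PL₊(I)` of orientation-preserving piecewise-linear homeomorphisms of
`I = [0,1]`, realized as the permutations of `ℝ` that fix every point outside `(0,1)`,
are strictly increasing, and are piecewise linear with finitely many breakpoints on `[0,1]`.
(Composition/inverse are the group operations of `Equiv.Perm ℝ`: `(g * h) t = g (h t)`.) -/
def PLPlus (g : Equiv.Perm ℝ) : Prop :=
  StrictMono (⇑g) ∧ (∀ t : ℝ, t ∉ Ioo (0 : ℝ) 1 → g t = t) ∧ PiecewiseLinearOn ⇑g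

/-- `PL₊^<(I)`: elements of `PL₊(I)` lying below the diagonal on `(0,1)`. -/
def PLPlusBelow (g : Equiv.Perm ℝ) : Prop :=
  PLPlus g ∧ ∀ t ∈ Ioo (0 : ℝ) 1, g t < t

/-- `PL₊^>(I)`: elements of `PL₊(I)` lying above the diagonal on `(0,1)`. -/
def PLPlusAbove (g : Equiv.Perm ℝ) : Prop :=
  PLPlus g ∧ ∀ t ∈ Ioo (0 : ℝ) 1, t < g t

/-- `f` has initial slope `q`, i.e. `f t = q·t` for all sufficiently small `t ≥ 0`. -/
def InitialSlope (f : ℝ → ℝ) (q : ℝ) : Prop :=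
  0 < q ∧ ∃ ε > (0 : ℝ), ∀ t ∈ Icc (0 : ℝ) ε, f t = q * t

/-- `f` has final slope `r`, i.e. `1 - f t = r·(1 - t)` for all `t` sufficiently close to `1`. -/
def FinalSlope (f : ℝ → ℝ) (r : ℝ) : Prop :=
  0 < r ∧ ∃ δ > (0 : ℝ), ∀ t ∈ Icc (1 - δ) (1 : ℝ), 1 - f t = r * (1 - t)

/-- `f` is affine on `[a, b]` for every nondegenerate `[a, b] ⊆ [0, 1]` whose interior avoids `S`.
This description of piecewise linearity is convenient for composition and inversion. -/
def AffineAwayFrom (f : ℝ → ℝ) (S : Finset ℝ) : Prop :=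
  ∀ a b : ℝ, 0 ≤ a → a < b → b ≤ 1 → (∀ s ∈ S, s ∉ Ioo a b) →
    ∃ c d : ℝ, ∀ x ∈ Icc a b, f x = c * x + d

theorem PiecewiseLinearOn.exists_affineAwayFrom {f : ℝ → ℝ} (hf : PiecewiseLinearOn f) :
    ∃ S, AffineAwayFrom f S := by
  obtain ⟨n, t, ht, h0, h1, haff⟩ := hf
  refine ⟨Finset.univ.image t, fun a b ha hab hb hS => ?_⟩
  have hS' : ∀ i, t i ≤ a ∨ b ≤ t i := fun i => by
    by_contra! h
    exact hS (t i) (Finset.mem_image_of_mem _ (Finset.mem_univ i)) h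
  obtain ⟨i, hia, hib⟩ : ∃ i : Fin n, t i.castSucc ≤ a ∧ b ≤ t i.succ := by
    by_contra! h
    have key : ∀ i : Fin (n + 1), t i ≤ a := by
      intro i
      induction i using Fin.induction with
      | zero => exact h0 ▸ ha
      | succ i ih => exact (hS' i.succ).resolve_right (not_le.2 (h i ih))
    have := key (Fin.last n)
    linarith
  obtain ⟨c, d, hcd⟩ := haff i
  exact ⟨c, d, fun x hx => hcd x ⟨hia.trans hx.1, hx.2.trans hib⟩⟩

theorem AffineAwayFrom.piecewiseLinearOn {f : ℝ → ℝ} {S : Finset ℝ} (hf : AffineAwayFrom f S) :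
    PiecewiseLinearOn f := by
  set T : Finset ℝ := insert 0 (insert 1 (S.filter (· ∈ Icc (0 : ℝ) 1))) with hT
  have hTI : ∀ x ∈ T, x ∈ Icc (0 : ℝ) 1 := by
    intro x hx
    simp only [hT, Finset.mem_insert, Finset.mem_filter] at hx
    rcases hx with rfl | rfl | hx
    · simp
    · simp
    · exact hx.2
  have h0T : (0 : ℝ) ∈ T := by simp [hT]
  have h1T : (1 : ℝ) ∈ T := by simp [hT]
  obtain ⟨n, hn⟩ : ∃ n, T.card = n + 1 :=
    Nat.exists_eq_succ_of_ne_zero (Finset.card_ne_zero_of_mem h0T)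
  set e := T.orderEmbOfFin hn with he
  have hmem : ∀ i, e i ∈ T := fun i => Finset.orderEmbOfFin_mem T hn i
  have hex : ∀ x ∈ T, ∃ i, e i = x := fun x hx => by
    have : x ∈ Set.range e := by rw [he, Finset.range_orderEmbOfFin]; exact hx
    exact this
  refine ⟨n, e, e.strictMono, ?_, ?_, fun i => ?_⟩
  · obtain ⟨i, hi⟩ := hex 0 h0T
    exact le_antisymm (hi ▸ e.monotone (Fin.zero_le i)) (hTI _ (hmem 0)).1
  · obtain ⟨i, hi⟩ := hex 1 h1T
    exact le_antisymm (hTI _ (hmem _)).2 (hi ▸ e.monotone (Fin.le_last i))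
  · refine hf _ _ (hTI _ (hmem _)).1 (e.strictMono i.castSucc_lt_succ) (hTI _ (hmem _)).2 ?_
    intro s hs hs'
    have hsT : s ∈ T := by
      simp only [hT, Finset.mem_insert, Finset.mem_filter]
      exact Or.inr (Or.inr ⟨hs, (hTI _ (hmem _)).1.trans hs'.1.le,
        hs'.2.le.trans (hTI _ (hmem _)).2⟩)
    obtain ⟨j, rfl⟩ := hex s hsT
    have h1 := e.lt_iff_lt.1 hs'.1
    have h2 := e.lt_iff_lt.1 hs'.2
    simp only [Fin.lt_def, Fin.val_castSucc, Fin.val_succ] at h1 h2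
    omega

theorem PiecewiseLinearOn.exists_affine_right {f : ℝ → ℝ} (hf : PiecewiseLinearOn f)
    {x y : ℝ} (hx : 0 ≤ x) (hxy : x < y) (hy : y ≤ 1) :
    ∃ v, x < v ∧ v ≤ y ∧ ∃ c d : ℝ, ∀ t ∈ Icc x v, f t = c * t + d := by
  obtain ⟨S, hS⟩ := hf.exists_affineAwayFrom
  set T := insert y (S.filter (x < ·))
  have hne : T.Nonempty := Finset.insert_nonempty _ _
  have hv : x < T.min' hne := by
    rcases Finset.mem_insert.1 (T.min'_mem hne) with h | h
    · exact hxy.trans_eq h.symm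
    · exact (Finset.mem_filter.1 h).2
  have hvy : T.min' hne ≤ y := T.min'_le _ (Finset.mem_insert_self _ _)
  refine ⟨T.min' hne, hv, hvy, hS _ _ hx hv (hvy.trans hy) fun s hs hs' => ?_⟩
  exact hs'.2.not_ge (T.min'_le _ (Finset.mem_insert_of_mem (Finset.mem_filter.2 ⟨hs, hs'.1⟩)))

theorem PiecewiseLinearOn.exists_affine_left {f : ℝ → ℝ} (hf : PiecewiseLinearOn f)
    {x y : ℝ} (hx : 0 ≤ x) (hxy : x < y) (hy : y ≤ 1) :
    ∃ u, u < y ∧ x ≤ u ∧ ∃ c d : ℝ, ∀ t ∈ Icc u y, f t = c * t + d := by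
  obtain ⟨S, hS⟩ := hf.exists_affineAwayFrom
  set T := insert x (S.filter (· < y))
  have hne : T.Nonempty := Finset.insert_nonempty _ _
  have hu : T.max' hne < y := by
    rcases Finset.mem_insert.1 (T.max'_mem hne) with h | h
    · exact h.trans_lt hxy
    · exact (Finset.mem_filter.1 h).2
  have hxu : x ≤ T.max' hne := T.le_max' _ (Finset.mem_insert_self _ _)
  refine ⟨T.max' hne, hu, hxu, hS _ _ (hx.trans hxu) hu hy fun s hs hs' => ?_⟩
  exact hs'.1.not_ge (T.le_max' _ (Finset.mem_insert_of_mem (Finset.mem_filter.2 ⟨hs, hs'.2⟩)))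

namespace PLPlus

variable {g h : Equiv.Perm ℝ}

theorem map_zero (hg : PLPlus g) : g 0 = 0 := hg.2.1 0 (by simp)

theorem map_one (hg : PLPlus g) : g 1 = 1 := hg.2.1 1 (by simp)

theorem map_nonneg (hg : PLPlus g) {t : ℝ} (ht : 0 ≤ t) : 0 ≤ g t :=
  hg.map_zero ▸ hg.1.monotone ht

theorem map_le_one (hg : PLPlus g) {t : ℝ} (ht : t ≤ 1) : g t ≤ 1 :=
  hg.map_one ▸ hg.1.monotone ht

theorem map_pos (hg : PLPlus g) {t : ℝ} (ht : 0 < t) : 0 < g t :=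
  hg.map_zero ▸ hg.1 ht

theorem map_lt_one (hg : PLPlus g) {t : ℝ} (ht : t < 1) : g t < 1 :=
  hg.map_one ▸ hg.1 ht

theorem one : PLPlus 1 := by
  refine ⟨strictMono_id, fun _ _ => rfl, 1, fun i => (i : ℝ), ?_, by simp, by simp,
    fun i => ⟨1, 0, fun x _ => by simp⟩⟩
  intro i j hij
  exact Nat.cast_lt.2 hij

theorem mul (hg : PLPlus g) (hh : PLPlus h) : PLPlus (g * h) := by
  refine ⟨hg.1.comp hh.1, fun t ht => ?_, ?_⟩
  · rw [Equiv.Perm.mul_apply, hh.2.1 t ht, hg.2.1 t ht]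
  · obtain ⟨S, hS⟩ := hg.2.2.exists_affineAwayFrom
    obtain ⟨T, hT⟩ := hh.2.2.exists_affineAwayFrom
    refine AffineAwayFrom.piecewiseLinearOn (S := T ∪ S.image ⇑h⁻¹) fun a b ha hab hb hST => ?_
    obtain ⟨c, d, hcd⟩ := hT a b ha hab hb fun s hs => hST s (Finset.mem_union_left _ hs)
    obtain ⟨c', d', hcd'⟩ := hS (h a) (h b) (hh.map_nonneg ha) (hh.1 hab) (hh.map_le_one hb)
      fun s hs hs' => hST (h⁻¹ s)
        (Finset.mem_union_right _ (Finset.mem_image_of_mem _ hs))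
        ⟨hh.1.lt_iff_lt.1 (by simpa using hs'.1), hh.1.lt_iff_lt.1 (by simpa using hs'.2)⟩
    refine ⟨c' * c, c' * d + d', fun x hx => ?_⟩
    rw [Equiv.Perm.mul_apply, hcd' _ ⟨hh.1.monotone hx.1, hh.1.monotone hx.2⟩, hcd x hx]
    ring

theorem inv (hg : PLPlus g) : PLPlus g⁻¹ := by
  have hmono : StrictMono ⇑g⁻¹ := fun x y hxy => hg.1.lt_iff_lt.1 (by simpa using hxy)
  have hfix : ∀ t : ℝ, t ∉ Ioo (0 : ℝ) 1 → g⁻¹ t = t := fun t ht =>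
    Equiv.Perm.inv_eq_iff_eq.2 (hg.2.1 t ht).symm
  refine ⟨hmono, hfix, ?_⟩
  obtain ⟨S, hS⟩ := hg.2.2.exists_affineAwayFrom
  refine AffineAwayFrom.piecewiseLinearOn (S := S.image g) fun a b ha hab hb hSab => ?_
  have h0 : g⁻¹ 0 = 0 := hfix 0 (by simp)
  have h1 : g⁻¹ 1 = 1 := hfix 1 (by simp)
  obtain ⟨c, d, hcd⟩ := hS (g⁻¹ a) (g⁻¹ b) (h0 ▸ hmono.monotone ha) (hmono hab)
    (h1 ▸ hmono.monotone hb) fun s hs hs' => hSab (g s) (Finset.mem_image_of_mem _ hs)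
      ⟨by simpa using hg.1 hs'.1, by simpa using hg.1 hs'.2⟩
  have hinv : ∀ x ∈ Icc a b, x = c * g⁻¹ x + d := fun x hx => by
    simpa using hcd (g⁻¹ x) ⟨hmono.monotone hx.1, hmono.monotone hx.2⟩
  have hc : c ≠ 0 := by
    rintro rfl
    have ha' := hinv a ⟨le_rfl, hab.le⟩
    have hb' := hinv b ⟨hab.le, le_rfl⟩
    linarith
  refine ⟨c⁻¹, -(c⁻¹ * d), fun x hx => ?_⟩
  have := hinv x hx
  field_simp
  linarith

theorem exists_initialSlope (hg : PLPlus g) : ∃ q, InitialSlope g q := by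
  obtain ⟨v, hv, hv1, c, d, hcd⟩ := hg.2.2.exists_affine_right le_rfl zero_lt_one le_rfl
  have hd : d = 0 := by
    have := hcd 0 ⟨le_rfl, hv.le⟩
    rw [hg.map_zero] at this
    linarith
  subst hd
  refine ⟨c, ?_, v, hv, fun t ht => by simpa using hcd t ht⟩
  have h1 := hcd v ⟨hv.le, le_rfl⟩
  have h2 := hg.map_pos hv
  exact pos_of_mul_pos_left (by linarith) hv.le

theorem exists_finalSlope (hg : PLPlus g) : ∃ r, FinalSlope g r := by
  obtain ⟨u, hu, hu0, c, d, hcd⟩ := hg.2.2.exists_affine_left le_rfl zero_lt_one le_rfl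
  have h1 := hcd 1 ⟨hu.le, le_rfl⟩
  rw [hg.map_one] at h1
  refine ⟨c, ?_, 1 - u, by linarith, fun t ht => ?_⟩
  · have h2 := hcd u ⟨le_rfl, hu.le⟩
    have h3 := hg.map_lt_one hu
    refine pos_of_mul_pos_left (b := 1 - u) ?_ (by linarith)
    linarith
  · rw [hcd t ⟨by linarith [ht.1], ht.2⟩]
    linarith

end PLPlus

namespace InitialSlope

theorem unique {f : ℝ → ℝ} {p q : ℝ} (hp : InitialSlope f p) (hq : InitialSlope f q) : p = q := by
  obtain ⟨-, ε, hε, hp⟩ := hp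
  obtain ⟨-, η, hη, hq⟩ := hq
  have hm : 0 < min ε η := lt_min hε hη
  have h1 := hp _ ⟨hm.le, min_le_left _ _⟩
  rw [hq _ ⟨hm.le, min_le_right _ _⟩] at h1
  exact (mul_right_cancel₀ hm.ne' h1).symm

theorem comp {f g : ℝ → ℝ} {p q : ℝ} (hp : InitialSlope f p) (hq : InitialSlope g q) :
    InitialSlope (f ∘ g) (p * q) := by
  obtain ⟨hp0, ε, hε, hp⟩ := hp
  obtain ⟨hq0, η, hη, hq⟩ := hq
  refine ⟨mul_pos hp0 hq0, min η (ε / q), lt_min hη (by positivity), fun t ht => ?_⟩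
  have h1 : t * q ≤ ε := (le_div_iff₀ hq0).1 (ht.2.trans (min_le_right _ _))
  rw [Function.comp_apply, hq t ⟨ht.1, ht.2.trans (min_le_left _ _)⟩,
    hp _ ⟨mul_nonneg hq0.le ht.1, by linarith⟩]
  ring

end InitialSlope

open Classical in
/-- The logarithm of the initial slope of `f` (and `0` if `f` has none). -/
noncomputable def logInitialSlope (f : ℝ → ℝ) : ℝ :=
  if h : ∃ q, InitialSlope f q then Real.log h.choose else 0

theorem InitialSlope.logInitialSlope_eq {f : ℝ → ℝ} {q : ℝ} (hq : InitialSlope f q) :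
    logInitialSlope f = Real.log q := by
  have h : ∃ q, InitialSlope f q := ⟨q, hq⟩
  rw [logInitialSlope, dif_pos h, h.choose_spec.unique hq]

/-- The centralizer of `z` in `PL₊(I)`, as a subgroup of `Equiv.Perm ℝ`. -/
def plCentralizer (z : Equiv.Perm ℝ) : Subgroup (Equiv.Perm ℝ) where
  carrier := {g | PLPlus g ∧ g * z = z * g}
  mul_mem' hg hh := ⟨hg.1.mul hh.1, Commute.mul_left hg.2 hh.2⟩
  one_mem' := ⟨PLPlus.one, Commute.one_left z⟩
  inv_mem' hg := ⟨hg.1.inv, Commute.inv_left hg.2⟩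

/-- The logarithm of the initial slope is a homomorphism on the centralizer. -/
noncomputable def logInitialSlopeHom (z : Equiv.Perm ℝ) : Additive (plCentralizer z) →+ ℝ :=
  AddMonoidHom.mk' (fun g => logInitialSlope (g.toMul : Equiv.Perm ℝ)) fun g h => by
    obtain ⟨p, hp⟩ := g.toMul.2.1.exists_initialSlope
    obtain ⟨q, hq⟩ := h.toMul.2.1.exists_initialSlope
    rw [hp.logInitialSlope_eq, hq.logInitialSlope_eq, ← Real.log_mul hp.1.ne' hq.1.ne']
    exact (hp.comp hq).logInitialSlope_eq

namespace PLPlusAbove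

variable {z g : Equiv.Perm ℝ}

theorem pow_mem_plCentralizer (hz : PLPlusAbove z) (n : ℕ) : z ^ n ∈ plCentralizer z :=
  (plCentralizer z).pow_mem ⟨hz.1, rfl⟩ n

theorem le_apply (hz : PLPlusAbove z) (t : ℝ) : t ≤ z t := by
  by_cases ht : t ∈ Ioo (0 : ℝ) 1
  · exact (hz.2 t ht).le
  · exact (hz.1.2.1 t ht).ge

theorem exists_lt_pow_apply (hz : PLPlusAbove z) {x y : ℝ} (hx : 0 < x) (hy : y < 1) :
    ∃ n : ℕ, y < (z ^ n) x := by
  by_contra! h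
  set A := Set.range fun n : ℕ => (z ^ n) x
  have hA : BddAbove A := ⟨y, by rintro _ ⟨n, rfl⟩; exact h n⟩
  have hne : A.Nonempty := Set.range_nonempty _
  have hxL : x ≤ sSup A := le_csSup hA ⟨0, rfl⟩
  have hLy : sSup A ≤ y := csSup_le hne (by rintro _ ⟨n, rfl⟩; exact h n)
  have hL : z.symm (sSup A) < sSup A := by
    rw [← hz.1.1.lt_iff_lt, z.apply_symm_apply]
    exact hz.2 _ ⟨by linarith, by linarith⟩
  obtain ⟨_, ⟨n, rfl⟩, hn⟩ := exists_lt_of_lt_csSup hne hL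
  have h1 := hz.1.1 hn
  rw [z.apply_symm_apply] at h1
  have h2 : (z ^ (n + 1)) x ≤ sSup A := le_csSup hA ⟨n + 1, rfl⟩
  rw [pow_succ', Equiv.Perm.mul_apply] at h2
  exact h2.not_gt h1

theorem one_lt_of_initialSlope (hz : PLPlusAbove z) {a : ℝ} (ha : InitialSlope z a) : 1 < a := by
  obtain ⟨-, ε, hε, ha⟩ := ha
  have hm : 0 < min ε 2⁻¹ := lt_min hε (by norm_num)
  have h1 := hz.2 (min ε 2⁻¹) ⟨hm, (min_le_right _ _).trans_lt (by norm_num)⟩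
  rw [ha _ ⟨hm.le, min_le_left _ _⟩] at h1
  exact (lt_mul_iff_one_lt_left hm).1 h1

theorem lt_one_of_finalSlope (hz : PLPlusAbove z) {b : ℝ} (hb : FinalSlope z b) : b < 1 := by
  obtain ⟨-, δ, hδ, hb⟩ := hb
  have hm : 0 < min δ 2⁻¹ := lt_min hδ (by norm_num)
  have h2 : min δ 2⁻¹ ≤ (2⁻¹ : ℝ) := min_le_right _ _
  have h1 := hz.2 (1 - min δ 2⁻¹) ⟨by linarith, by linarith⟩
  have h3 := hb (1 - min δ 2⁻¹) ⟨by linarith [min_le_left δ 2⁻¹], by linarith⟩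
  refine (mul_lt_iff_lt_one_left hm).1 ?_
  linarith

/-- An element of the centralizer is linear as long as it stays in the linear domain of `z`
at `0`. -/
theorem apply_eq_mul_of_slope_mul_le (hg : g ∈ plCentralizer z) {a ε q : ℝ}
    (ha : 1 < a) (hza : ∀ t ∈ Icc 0 ε, z t = a * t) (hq : InitialSlope g q)
    {t : ℝ} (ht0 : 0 ≤ t) (ht : t ≤ ε) (hqt : q * t ≤ ε) : g t = q * t := by
  obtain ⟨hq0, η, hη, hq⟩ := hq
  have ha0 : 0 < a := by linarith
  have key : ∀ n : ℕ, ∀ t, 0 ≤ t → t ≤ ε → q * t ≤ ε → t ≤ η * a ^ n → g t = q * t := by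
    intro n
    induction n with
    | zero => exact fun t ht0 _ _ h => hq t ⟨ht0, by simpa using h⟩
    | succ n ih =>
      intro t ht0 ht hqt h
      have hta : t / a ≤ t := div_le_self ht0 ha.le
      have hta0 : 0 ≤ t / a := by positivity
      have hqta : q * (t / a) ≤ ε := (mul_le_mul_of_nonneg_left hta hq0.le).trans hqt
      have hzt : z (t / a) = t := by
        rw [hza _ ⟨hta0, hta.trans ht⟩]
        field_simp
      have hcomm : g t = z (g (t / a)) := by
        rw [← Equiv.Perm.mul_apply, ← hg.2, Equiv.Perm.mul_apply, hzt]
      have hga : g (t / a) = q * (t / a) := ih _ hta0 (hta.trans ht) hqta (by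
        rw [div_le_iff₀ ha0]
        rw [pow_succ] at h
        linarith)
      rw [hcomm, hga, hza _ ⟨by positivity, hqta⟩]
      field_simp
  obtain ⟨n, hn⟩ := pow_unbounded_of_one_lt (t / η) ha
  exact key n t ht0 ht hqt (by rw [div_lt_iff₀ hη] at hn; linarith)

/-- An element of the centralizer is affine as long as it stays in the affine domain of `z`
at `1`. -/
theorem one_sub_apply_eq_mul_of_commute (hz : PLPlusAbove z) (hg : g ∈ plCentralizer z)
    {b δ r : ℝ} (hb0 : 0 < b) (hb : b < 1) (hzb : ∀ t ∈ Icc (1 - δ) 1, 1 - z t = b * (1 - t))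
    (hr : FinalSlope g r) {t : ℝ} (ht1 : t ≤ 1) (ht : 1 - δ ≤ t) (hgt : 1 - δ ≤ g t) :
    1 - g t = r * (1 - t) := by
  obtain ⟨-, η, hη, hr⟩ := hr
  have key : ∀ n : ℕ, ∀ t, t ≤ 1 → 1 - δ ≤ t → 1 - δ ≤ g t → b ^ n * (1 - t) ≤ η →
      1 - g t = r * (1 - t) := by
    intro n
    induction n with
    | zero => exact fun t ht1 _ _ h => hr t ⟨by simp at h; linarith, ht1⟩
    | succ n ih =>
      intro t ht1 ht hgt h
      have hcomm : g (z t) = z (g t) := by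
        rw [← Equiv.Perm.mul_apply, hg.2, Equiv.Perm.mul_apply]
      have hzt := hzb t ⟨ht, ht1⟩
      have h1 := ih (z t) (hz.1.map_le_one ht1) (ht.trans (hz.le_apply t))
        (hcomm ▸ hgt.trans (hz.le_apply _)) (by rw [hzt]; rw [pow_succ] at h; linarith)
      rw [hcomm, hzb _ ⟨hgt, hg.1.map_le_one ht1⟩, hzt] at h1
      refine mul_left_cancel₀ hb0.ne' ?_
      linarith
  obtain ⟨n, hn⟩ := exists_pow_lt_of_lt_one (show 0 < η / (1 - t + 1) by
    apply div_pos hη; linarith) hb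
  rw [lt_div_iff₀ (by linarith)] at hn
  have : 0 < b ^ n := by positivity
  exact key n t ht1 ht hgt (by linarith)

theorem eq_one_of_initialSlope_one (hz : PLPlusAbove z) (hg : g ∈ plCentralizer z)
    (h1 : InitialSlope g 1) : g = 1 := by
  obtain ⟨-, ε, hε, h1⟩ := h1
  ext t
  rw [Equiv.Perm.one_apply]
  by_cases ht : t ∈ Ioo (0 : ℝ) 1
  · obtain ⟨n, hn⟩ := hz.exists_lt_pow_apply hε ht.2
    have hzn := hz.pow_mem_plCentralizer n
    obtain ⟨s, rfl⟩ := (z ^ n).surjective t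
    have hs : s < ε := hzn.1.1.lt_iff_lt.1 hn
    have hs0 : 0 < s := hzn.1.1.lt_iff_lt.1 (by rw [hzn.1.map_zero]; exact ht.1)
    have hcomm : g * z ^ n = z ^ n * g := Commute.pow_right hg.2 n
    rw [← Equiv.Perm.mul_apply, hcomm, Equiv.Perm.mul_apply, h1 s ⟨hs0.le, hs.le⟩, one_mul]
  · exact hg.1.2.1 t ht

/-- The initial slopes of elements of the centralizer do not accumulate at `1` from above. -/
theorem exists_forall_initialSlope_le (hz : PLPlusAbove z) :
    ∃ κ : ℝ, 1 < κ ∧ ∀ g ∈ plCentralizer z, ∀ q, InitialSlope g q → 1 < q → κ ≤ q := by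
  obtain ⟨a, haz⟩ := hz.1.exists_initialSlope
  obtain ⟨b, hbz⟩ := hz.1.exists_finalSlope
  have ha := hz.one_lt_of_initialSlope haz
  have hb := hz.lt_one_of_finalSlope hbz
  obtain ⟨-, ε, hε, hza⟩ := haz
  obtain ⟨hb0, δ, hδ, hzb⟩ := hbz
  set x := min ε 1 / 2 with hx
  have hm : 0 < min ε 1 := lt_min hε one_pos
  have hx0 : 0 < x := by positivity
  obtain ⟨N, hN⟩ := hz.exists_lt_pow_apply hx0 (show 1 - δ < 1 by linarith)
  have hψ := hz.pow_mem_plCentralizer N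
  set ψ := z ^ N
  obtain ⟨v, hxv, hvm, α, β, hαβ⟩ := hψ.1.2.2.exists_affine_right hx0.le
    (show x < min ε 1 by rw [hx]; linarith) (min_le_right _ _)
  have hα : 0 < α := by
    have h1 := hψ.1.1 hxv
    rw [hαβ x ⟨le_rfl, hxv.le⟩, hαβ v ⟨hxv.le, le_rfl⟩] at h1
    exact pos_of_mul_pos_left (b := v - x) (by linarith) (by linarith)
  refine ⟨v / x, (one_lt_div hx0).2 hxv, fun g hg q hq hq1 => ?_⟩
  by_contra! hqv
  obtain ⟨r, hr⟩ := hg.1.exists_finalSlope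
  have hq0 : 0 < q := by linarith
  have hxq : x < v / q := by
    rw [lt_div_iff₀ hx0] at hqv
    rw [lt_div_iff₀ hq0]
    linarith
  have hvε : v ≤ ε := hvm.trans (min_le_left _ _)
  have hv1 : v ≤ 1 := hvm.trans (min_le_right _ _)
  have key : ∀ t, x ≤ t → t ≤ v / q → 1 - (α * (q * t) + β) = r * (1 - (α * t + β)) := by
    intro t hxt htv
    have ht0 : 0 < t := hx0.trans_le hxt
    have hqt : q * t ≤ v := by rw [le_div_iff₀ hq0] at htv; linarith
    have htqt : t ≤ q * t := le_mul_of_one_le_left ht0.le hq1.le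
    have hgt : g t = q * t := apply_eq_mul_of_slope_mul_le hg ha hza hq ht0.le
      ((htqt.trans hqt).trans hvε) (hqt.trans hvε)
    have hcomm : g (ψ t) = ψ (q * t) := by
      rw [← hgt, ← Equiv.Perm.mul_apply, ← Equiv.Perm.mul_apply]
      exact DFunLike.congr_fun (Commute.pow_right hg.2 N) t
    have hψt : 1 - δ ≤ ψ t := hN.le.trans (hψ.1.1.monotone hxt)
    have h1 := hz.one_sub_apply_eq_mul_of_commute hg hb0 hb hzb hr
      (hψ.1.map_le_one ((htqt.trans hqt).trans hv1)) hψt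
      (hcomm ▸ hψt.trans (hψ.1.1.monotone htqt))
    rwa [hcomm, hαβ t ⟨hxt, htqt.trans hqt⟩, hαβ (q * t) ⟨hxt.trans htqt, hqt⟩] at h1
  have k1 := key x le_rfl hxq.le
  have k2 := key (v / q) hxq.le le_rfl
  have hqr : q = r := by
    have h1 : (q - r) * (α * (v / q - x)) = 0 := by linarith
    rcases mul_eq_zero.1 h1 with h | h
    · linarith
    · exact absurd h (mul_pos hα (by linarith)).ne'
  subst hqr
  have hβ : β = 1 := by
    have h1 : (q - 1) * (β - 1) = 0 := by linarith
    rcases mul_eq_zero.1 h1 with h | h <;> linarith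
  have h2 := hψ.1.map_lt_one (hxv.trans_le hv1)
  rw [hαβ x ⟨le_rfl, hxv.le⟩, hβ] at h2
  have := mul_pos hα hx0
  linarith

theorem logInitialSlopeHom_injective (hz : PLPlusAbove z) :
    Function.Injective (logInitialSlopeHom z) := by
  rw [injective_iff_map_eq_zero]
  intro g hg
  obtain ⟨q, hq⟩ := g.toMul.2.1.exists_initialSlope
  have h0 : Real.log q = 0 := hq.logInitialSlope_eq.symm.trans hg
  obtain rfl : q = 1 := Real.eq_one_of_pos_of_log_eq_zero hq.1 h0
  exact Subtype.ext (hz.eq_one_of_initialSlope_one g.toMul.2 hq)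

theorem exists_range_logInitialSlopeHom_eq (hz : PLPlusAbove z) :
    ∃ b : ℝ, b ≠ 0 ∧ (logInitialSlopeHom z).range = AddSubgroup.zmultiples b := by
  obtain ⟨κ, hκ, hmin⟩ := hz.exists_forall_initialSlope_le
  obtain ⟨b, hb⟩ := AddSubgroup.cyclic_of_isolated_zero (H := (logInitialSlopeHom z).range)
    (Real.log_pos hκ) (by
      rw [Set.disjoint_left]
      rintro _ ⟨g, rfl⟩ hg
      obtain ⟨q, hq⟩ := g.toMul.2.1.exists_initialSlope
      have hgq : logInitialSlopeHom z g = Real.log q := hq.logInitialSlope_eq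
      rw [hgq] at hg
      exact hg.2.not_ge (Real.log_le_log (by linarith)
        (hmin _ g.toMul.2 q hq ((Real.log_pos_iff hq.1.le).1 hg.1))))
  rw [← AddSubgroup.zmultiples_eq_closure] at hb
  refine ⟨b, ?_, hb⟩
  rintro rfl
  obtain ⟨a, ha⟩ := hz.1.exists_initialSlope
  have h1 : logInitialSlopeHom z (Additive.ofMul ⟨z, hz.1, rfl⟩) = Real.log a :=
    ha.logInitialSlope_eq
  have h2 : Real.log a ∈ (logInitialSlopeHom z).range := ⟨_, h1⟩
  rw [hb, AddSubgroup.zmultiples_zero_eq_bot, AddSubgroup.mem_bot] at h2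
  exact (Real.log_pos (hz.one_lt_of_initialSlope ha)).ne' h2

/-- The centralizer of a one-bump function is infinite cyclic. -/
theorem exists_addEquiv_int (hz : PLPlusAbove z) :
    Nonempty (Additive (plCentralizer z) ≃+ ℤ) := by
  obtain ⟨b, hb0, hb⟩ := hz.exists_range_logInitialSlopeHom_eq
  let e₁ := AddMonoidHom.ofInjective hz.logInitialSlopeHom_injective
  let f : ℤ →+ ℝ := zmultiplesHom ℝ b
  have hf : Function.Injective f := by
    rw [injective_iff_map_eq_zero]
    intro n hn
    simpa [f, hb0] using hn
  have hfr : (logInitialSlopeHom z).range = f.range := by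
    rw [hb]
    rfl
  exact ⟨(e₁.trans (AddEquiv.addSubgroupCongr hfr)).trans (AddMonoidHom.ofInjective hf).symm⟩

end PLPlusAbove

/-- for a one-bump `z ∈ PL₊^>(I)`, the centralizer
`C(z) = {g ∈ PL₊(I) : g ∘ z = z ∘ g}` is isomorphic to the infinite cyclic group `ℤ`:
there is a map `φ` restricting to a bijection `C(z) → ℤ` with
`φ(g₁ ∘ g₂) = φ(g₁) + φ(g₂)` on `C(z)`. -/
theorem centralizer_isomorphic_to_int (z : Equiv.Perm ℝ)
    (hz : PLPlusAbove z) :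
    ∃ φ : Equiv.Perm ℝ → ℤ,
      Set.BijOn φ {g : Equiv.Perm ℝ | PLPlus g ∧ g * z = z * g} Set.univ ∧
      ∀ g₁ ∈ {g : Equiv.Perm ℝ | PLPlus g ∧ g * z = z * g},
        ∀ g₂ ∈ {g : Equiv.Perm ℝ | PLPlus g ∧ g * z = z * g},
          φ (g₁ * g₂) = φ g₁ + φ g₂ := by
  classical
  obtain ⟨e⟩ := hz.exists_addEquiv_int
  have hφ : ∀ g (hg : g ∈ plCentralizer z),
      (if h : g ∈ plCentralizer z then e (Additive.ofMul ⟨g, h⟩) else 0) =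
        e (Additive.ofMul ⟨g, hg⟩) := fun g hg => dif_pos hg
  refine ⟨fun g => if h : g ∈ plCentralizer z then e (Additive.ofMul ⟨g, h⟩) else 0,
    ⟨Set.mapsTo_univ _ _, fun g hg h hh hgh => ?_, fun n _ => ?_⟩, fun g hg h hh => ?_⟩
  · simp only [hφ g hg, hφ h hh] at hgh
    exact congrArg Subtype.val (Additive.ofMul.injective (e.injective hgh))
  · refine ⟨(e.symm n).toMul, (e.symm n).toMul.2, ?_⟩
    exact (hφ _ (e.symm n).toMul.2).trans (e.apply_symm_apply n)
  · simp only [hφ g hg, hφ h hh, hφ _ ((plCentralizer z).mul_mem hg hh)]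
    exact e.map_add (Additive.ofMul ⟨g, hg⟩) (Additive.ofMul ⟨h, hh⟩)
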